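/- SLD-resolution is sound and complete for propositional Horn formulas: a Horn formula F is unsatisfiable if and only if there exists an SLD-resolution refutation of F. -/

import Mathlib

attribute [local instance] Classical.propDecidable

namespace QHornProlog

/-- Propositional variables. -/
abbrev Var := ℕ
/-- A literal is a variable together with a polarity (`true` = positive). -/
abbrev Lit := Var × Bool
/-- A clause is a finite set of literals. -/
abbrev Clause := Finset Lit
/-- A CNF formula is a finite set of clauses. -/
abbrev CNF := Finset Clause
/-- A Boolean assignment to the variables. -/
abbrev Assignment := Var → Bool

/-- An assignment makes a literal true. -/
def litSat (a : Assignment) (l : Lit) : Prop := a l.1 = l.2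
/-- An assignment satisfies a clause if some literal of it is made true. -/
def clauseSat (a : Assignment) (C : Clause) : Prop := ∃ l ∈ C, litSat a l
/-- An assignment satisfies a CNF if it satisfies every clause. -/
def cnfSat (a : Assignment) (F : CNF) : Prop := ∀ C ∈ F, clauseSat a C
/-- A CNF formula is satisfiable if some assignment satisfies it. -/
def CnfSatisfiable (F : CNF) : Prop := ∃ a, cnfSat a F

/-- The positive literals of a clause. -/
def posLits (C : Clause) : Clause := C.filter (fun l => l.2 = true)
/-- A Horn clause has at most one positive literal. -/
def IsHornClause (C : Clause) : Prop := (posLits C).card ≤ 1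
/-- A definite Horn clause has exactly one positive literal. -/
def IsDefiniteClause (C : Clause) : Prop := (posLits C).card = 1
/-- A negative (goal) clause has only negative literals. -/
def IsNegativeClause (C : Clause) : Prop := ∀ l ∈ C, l.2 = false
/-- A Horn formula consists of Horn clauses. -/
def IsHornFormula (F : CNF) : Prop := ∀ C ∈ F, IsHornClause C

/-- `R` is the resolvent of `C` and `D` on pivot `x`. -/
def IsResolvent (C D R : Clause) (x : Var) : Prop :=
  (x, true) ∈ C ∧ (x, false) ∈ D ∧ R = C.erase (x, true) ∪ D.erase (x, false)

/-- A unit resolution refutation of `F`: a sequence of clauses ending in the empty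
clause, each either in `F` or a resolvent of two earlier clauses where at least one
premise is a unit clause. -/
def IsUnitResRefutation (F : CNF) (L : List Clause) : Prop :=
  L ≠ [] ∧ L.getLast? = some (∅ : Clause) ∧
  ∀ i (hi : i < L.length),
    L.get ⟨i, hi⟩ ∈ F ∨
    ∃ j k, ∃ (hj : j < i) (hk : k < i), ∃ x : Var,
      ((L.get ⟨j, hj.trans hi⟩).card = 1 ∨ (L.get ⟨k, hk.trans hi⟩).card = 1) ∧
      IsResolvent (L.get ⟨j, hj.trans hi⟩) (L.get ⟨k, hk.trans hi⟩) (L.get ⟨i, hi⟩) x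

/-- An SLD-resolution refutation of `F`: a sequence of negative clauses starting at a
goal clause of `F`, each next clause the resolvent of the previous (centre) clause with
a definite clause of `F` (side clause) on its head, ending in the empty clause. -/
def IsSLDRefutation (F : CNF) (L : List Clause) : Prop :=
  ∃ h : L ≠ [],
    L.head h ∈ F ∧ IsNegativeClause (L.head h) ∧ L.getLast h = (∅ : Clause) ∧
    ∀ i (hi : i + 1 < L.length),
      ∃ C ∈ F, ∃ x : Var,
        posLits C = {(x, true)} ∧ (x, false) ∈ L.get ⟨i, Nat.lt_of_succ_lt hi⟩ ∧
        L.get ⟨i + 1, hi⟩ =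
          (L.get ⟨i, Nat.lt_of_succ_lt hi⟩).erase (x, false) ∪ C.erase (x, true)

/-! ### Quantified Boolean formulas in closed prenex form -/

/-- A quantifier prefix: a list of blocks, each a quantifier (`true` = ∃, `false` = ∀)
together with a finite set of variables. -/
abbrev QPrefix := List (Bool × Finset Var)

/-- All variables occurring in the prefix. -/
def prefixVars (Pf : QPrefix) : Finset Var := Pf.foldr (fun p s => p.2 ∪ s) ∅
/-- Variables of a clause. -/
def clauseVars (C : Clause) : Finset Var := C.image Prod.fst
/-- Variables of a CNF. -/
def cnfVars (F : CNF) : Finset Var := F.sup clauseVars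

/-- Override an assignment on the set `X` by the assignment `b`. -/
def override (a : Assignment) (X : Finset Var) (b : Assignment) : Assignment :=
  fun v => if v ∈ X then b v else a v

/-- Recursive truth evaluation of a prenex QBF relative to an ambient assignment:
an ∃-block requires some assignment of its variables, a ∀-block requires all. -/
def QEval : QPrefix → CNF → Assignment → Prop
  | [], φ, a => cnfSat a φ
  | (true, X) :: Pf, φ, a => ∃ b, QEval Pf φ (override a X b)
  | (false, X) :: Pf, φ, a => ∀ b, QEval Pf φ (override a X b)

/-- Truth of a closed prenex QBF. -/
def QTrue (Pf : QPrefix) (φ : CNF) : Prop := QEval Pf φ (fun _ => false)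

/-- `Pf.φ` is a closed prenex QBF: the blocks are pairwise disjoint and every variable
of the matrix is quantified. -/
def ClosedQBF (Pf : QPrefix) (φ : CNF) : Prop :=
  Pf.Pairwise (fun p q => Disjoint p.2 q.2) ∧ cnfVars φ ⊆ prefixVars Pf

/-- A variable is existential if it lies in an ∃-block. -/
def IsExistential (Pf : QPrefix) (v : Var) : Prop := ∃ p ∈ Pf, p.1 = true ∧ v ∈ p.2
/-- A variable is universal if it lies in a ∀-block. -/
def IsUniversal (Pf : QPrefix) (v : Var) : Prop := ∃ p ∈ Pf, p.1 = false ∧ v ∈ p.2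
/-- A quantified Horn formula: a closed prenex QBF with a Horn matrix. -/
def IsQHorn (Pf : QPrefix) (φ : CNF) : Prop := ClosedQBF Pf φ ∧ IsHornFormula φ

/-- Variable `v` lies in block number `i` (0-indexed) of the prefix. -/
def hasLevel (Pf : QPrefix) (v : Var) (i : ℕ) : Prop :=
  ∃ h : i < Pf.length, v ∈ (Pf.get ⟨i, h⟩).2
/-- Variable `v` is at or to the left of variable `w` in the prefix ordering. -/
def levelLE (Pf : QPrefix) (v w : Var) : Prop :=
  ∃ i j, i ≤ j ∧ hasLevel Pf v i ∧ hasLevel Pf w j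

/-- Clauses of the matrix with exactly one positive literal, which is existential. -/
noncomputable def Fexist (Pf : QPrefix) (φ : CNF) : CNF :=
  φ.filter (fun C => ∃ x, posLits C = {(x, true)} ∧ IsExistential Pf x)
/-- Clauses of the matrix with exactly one positive literal, which is universal. -/
noncomputable def Fforall (Pf : QPrefix) (φ : CNF) : CNF :=
  φ.filter (fun C => ∃ x, posLits C = {(x, true)} ∧ IsUniversal Pf x)
/-- Goal clauses: clauses with only negative literals. -/
noncomputable def Fgoal (φ : CNF) : CNF := φ.filter IsNegativeClause

/-- One SLD-Q-resolution step from centre clause `N` to `N'`: either resolution with a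
definite clause of `φ` on its existential head, or universal reduction of a universal
literal not blocked by any existential literal at or to its right. -/
def SLDQStep (Pf : QPrefix) (φ : CNF) (N N' : Clause) : Prop :=
  (∃ C ∈ φ, ∃ x : Var, posLits C = {(x, true)} ∧ IsExistential Pf x ∧
     (x, false) ∈ N ∧ N' = N.erase (x, false) ∪ C.erase (x, true)) ∨
  (∃ l ∈ N, IsUniversal Pf l.1 ∧
     (∀ k ∈ N, IsExistential Pf k.1 → ¬ levelLE Pf l.1 k.1) ∧
     N' = N.erase l)

/-- An SLD-Q-resolution refutation of `Pf.φ`: a sequence of negative clauses starting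
at a goal clause of `φ`, proceeding by SLD-Q-resolution steps, ending in the empty
clause. -/
def IsSLDQRefutation (Pf : QPrefix) (φ : CNF) (L : List Clause) : Prop :=
  ∃ h : L ≠ [],
    L.head h ∈ φ ∧ IsNegativeClause (L.head h) ∧ L.getLast h = (∅ : Clause) ∧
    ∀ i (hi : i + 1 < L.length),
      SLDQStep Pf φ (L.get ⟨i, Nat.lt_of_succ_lt hi⟩) (L.get ⟨i + 1, hi⟩)

/-! ### Skolem-function models and logical equivalence -/

/-- A family of candidate Skolem functions: to every variable a function from
assignments to Booleans. -/
abbrev SkolemFamily := Var → Assignment → Bool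

/-- Variables of the first `i` blocks of the prefix. -/
def varsUpTo (Pf : QPrefix) (i : ℕ) : Finset Var := prefixVars (Pf.take i)

/-- Each Skolem function for an existential variable depends only on the variables
quantified to the left of it (i.e. in strictly earlier blocks). -/
def DependsOnlyOuter (Pf : QPrefix) (σ : SkolemFamily) : Prop :=
  ∀ i (hi : i < Pf.length), (Pf.get ⟨i, hi⟩).1 = true →
    ∀ v ∈ (Pf.get ⟨i, hi⟩).2, ∀ a b : Assignment,
      (∀ w ∈ varsUpTo Pf i, a w = b w) → σ v a = σ v b

/-- A complete assignment is consistent with the Skolem family if every existential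
variable takes the value prescribed by its Skolem function. -/
def ConsistentWith (Pf : QPrefix) (σ : SkolemFamily) (a : Assignment) : Prop :=
  ∀ v, IsExistential Pf v → a v = σ v a

/-- `σ` is a model of `Pf.φ`: its functions depend only on outer variables and every
consistent complete assignment satisfies the matrix. -/
def IsModel (Pf : QPrefix) (φ : CNF) (σ : SkolemFamily) : Prop :=
  DependsOnlyOuter Pf σ ∧ ∀ a : Assignment, ConsistentWith Pf σ a → cnfSat a φ

/-- Two QBFs with the same prefix are logically equivalent iff they have exactly the
same models. -/
def LogEquiv (Pf : QPrefix) (φ φ' : CNF) : Prop :=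
  ∀ σ : SkolemFamily, IsModel Pf φ σ ↔ IsModel Pf φ' σ

/-- The abstraction `Pf_i`: all variables of the first `i` blocks are made existential
and put in a single leading ∃-block. -/
def abstraction (Pf : QPrefix) (i : ℕ) : QPrefix :=
  (true, varsUpTo Pf i) :: Pf.drop i

/-- The complement of a literal. -/
def negLit (l : Lit) : Lit := (l.1, !l.2)

/-- `C̄`: the conjunction (CNF) of unit clauses `{¬ℓ}` for the literals `ℓ` of `C`. -/
def negUnits (C : Clause) : CNF := C.image (fun l => ({negLit l} : Clause))

/-- The outer clause `OC(Pf, D, m)`: literals of `D` other than `m` at or to the left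
of `m`. -/
noncomputable def outerClause (Pf : QPrefix) (D : Clause) (m : Lit) : Clause :=
  (D.erase m).filter (fun k => levelLE Pf k.1 m.1)

/-- The outer resolvent `OR(Pf, C, D, ℓ)`. -/
noncomputable def outerResolvent (Pf : QPrefix) (C D : Clause) (l : Lit) : Clause :=
  C.erase l ∪ outerClause Pf D (negLit l)

/-- Property QIOR⁺ of a clause `C` on literal `ℓ ∈ C` with respect to `Pf.ψ`. -/
def QIORplus (Pf : QPrefix) (ψ : CNF) (C : Clause) (l : Lit) : Prop :=
  l ∈ C ∧ ∀ D ∈ ψ, negLit l ∈ D → LogEquiv Pf ψ (insert (outerResolvent Pf C D l) ψ)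

/-- Restrict every block of a prefix to the variable set `V`. -/
def restrictPrefix (Pf : QPrefix) (V : Finset Var) : QPrefix :=
  Pf.map (fun p => (p.1, p.2 ∩ V))

/-- Normal form of a prefix: drop empty blocks and merge adjacent blocks carrying the
same quantifier. -/
def normalize : QPrefix → QPrefix
  | [] => []
  | p :: Pf =>
    let r := normalize Pf
    if p.2 = ∅ then r
    else
      match r with
      | [] => [p]
      | q :: r' => if p.1 = q.1 then (p.1, p.2 ∪ q.2) :: r' else p :: q :: r'

/-- `Pf'` extends `Pf` by the new variables `S`, placed arbitrarily in the prefix: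
the variables of `Pf'` are those of `Pf` together with `S`, and removing `S` from
`Pf'` gives back `Pf` (up to empty blocks and block splitting). -/
def PrefixExtends (Pf Pf' : QPrefix) (S : Finset Var) : Prop :=
  Disjoint (prefixVars Pf) S ∧
  prefixVars Pf' = prefixVars Pf ∪ S ∧
  normalize (restrictPrefix Pf' (prefixVars Pf)) = normalize Pf

/-- Renaming of a literal with respect to a set `S` of variables. -/
def renameLit (S : Finset Var) (l : Lit) : Lit := if l.1 ∈ S then negLit l else l
/-- Renaming of a clause. -/
def renameClause (S : Finset Var) (C : Clause) : Clause := C.image (renameLit S)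
/-- Renaming of a CNF matrix. -/
def renameCNF (S : Finset Var) (φ : CNF) : CNF := φ.image (renameClause S)


/-- One SLD-resolution step from the centre clause `N` to `N'` with a side clause of `F`. -/
def SLDStep (F : CNF) (N N' : Clause) : Prop :=
  ∃ C ∈ F, ∃ x : Var, posLits C = {(x, true)} ∧ (x, false) ∈ N ∧
    N' = N.erase (x, false) ∪ C.erase (x, true)

theorem SLDStep.clauseSat {F : CNF} {N N' : Clause} (h : SLDStep F N N') {a : Assignment}
    (ha : cnfSat a F) (hN : clauseSat a N) : clauseSat a N' := by
  obtain ⟨C, hC, x, -, -, rfl⟩ := h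
  obtain ⟨l, hl, hal⟩ := hN
  obtain ⟨k, hk, hak⟩ := ha C hC
  by_cases hlx : l = (x, false)
  · refine ⟨k, Finset.mem_union_right _ (Finset.mem_erase.2 ⟨?_, hk⟩), hak⟩
    rintro rfl
    subst hlx
    simp_all [litSat]
  · exact ⟨l, Finset.mem_union_left _ (Finset.mem_erase.2 ⟨hlx, hl⟩), hal⟩

theorem not_clauseSat_empty (a : Assignment) : ¬ clauseSat a ∅ := by
  simp [clauseSat]

theorem mem_posLits {C : Clause} {l : Lit} : l ∈ posLits C ↔ l ∈ C ∧ l.2 = true := by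
  simp [posLits]

theorem snd_eq_false_of_mem_erase {C : Clause} {x : Var} (hC : posLits C = {(x, true)})
    {l : Lit} (hl : l ∈ C.erase (x, true)) : l.2 = false := by
  obtain ⟨hne, hl⟩ := Finset.mem_erase.1 hl
  by_contra h
  have : l ∈ posLits C := mem_posLits.2 ⟨hl, by simpa using h⟩
  rw [hC, Finset.mem_singleton] at this
  exact hne this

/-- The variables derivable from `F` by at most `n` rounds of forward chaining. -/
def forwardStage (F : CNF) : ℕ → Set Var
  | 0 => ∅
  | n + 1 => {x | ∃ C ∈ F, posLits C = {(x, true)} ∧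
      ∀ l ∈ C.erase (x, true), l.1 ∈ forwardStage F n}

theorem forwardStage_mono (F : CNF) : Monotone (forwardStage F) := by
  refine monotone_nat_of_le_succ fun n => ?_
  induction n with
  | zero => exact Set.empty_subset _
  | succ n ih =>
    rintro x ⟨C, hC, hx, hb⟩
    exact ⟨C, hC, hx, fun l hl => ih (hb l hl)⟩

theorem exists_forwardStage_of_forall {F : CNF} (C : Clause)
    (h : ∀ l ∈ C, ∃ n, l.1 ∈ forwardStage F n) : ∃ n, ∀ l ∈ C, l.1 ∈ forwardStage F n := by
  choose! f hf using h
  exact ⟨C.sup f, fun l hl => forwardStage_mono F (Finset.le_sup hl) (hf l hl)⟩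

/-- A negative clause over forward derivable variables can be resolved down to one over
variables derivable one round earlier. -/
theorem exists_reflTransGen_forwardStage (F : CNF) (n : ℕ) (N : Clause)
    (hneg : IsNegativeClause N) (hN : ∀ l ∈ N, l.1 ∈ forwardStage F (n + 1)) :
    ∃ N', Relation.ReflTransGen (SLDStep F) N N' ∧ IsNegativeClause N' ∧
      ∀ l ∈ N', l.1 ∈ forwardStage F n := by
  induction hk : (N.filter fun l => l.1 ∉ forwardStage F n).card using Nat.strong_induction_on
    generalizing N with
  | _ k ih =>
    by_cases hall : ∀ l ∈ N, l.1 ∈ forwardStage F n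
    · exact ⟨N, .refl, hneg, hall⟩
    push Not at hall
    obtain ⟨⟨x, b⟩, hl, hx⟩ := hall
    obtain rfl : b = false := hneg _ hl
    obtain ⟨C, hC, hpos, hbody⟩ := hN _ hl
    have hlt : ((N.erase (x, false) ∪ C.erase (x, true)).filter
        fun l => l.1 ∉ forwardStage F n).card < k := by
      rw [← hk]
      refine Finset.card_lt_card ((Finset.ssubset_iff_of_subset fun l h => ?_).2
        ⟨(x, false), Finset.mem_filter.2 ⟨hl, hx⟩, fun h => ?_⟩)
      · obtain ⟨h, hn⟩ := Finset.mem_filter.1 h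
        rcases Finset.mem_union.1 h with h | h
        · exact Finset.mem_filter.2 ⟨Finset.mem_of_mem_erase h, hn⟩
        · exact absurd (hbody l h) hn
      · obtain ⟨h, hn⟩ := Finset.mem_filter.1 h
        rcases Finset.mem_union.1 h with h | h
        · exact (Finset.mem_erase.1 h).1 rfl
        · exact hn (hbody _ h)
    obtain ⟨N', hN', hneg', hstage⟩ := ih _ hlt _
      (fun l h => (Finset.mem_union.1 h).elim (fun h => hneg l (Finset.mem_of_mem_erase h))
        (snd_eq_false_of_mem_erase hpos))
      (fun l h => (Finset.mem_union.1 h).elim (fun h => hN l (Finset.mem_of_mem_erase h))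
        (fun h => forwardStage_mono F n.le_succ (hbody l h))) rfl
    exact ⟨N', .head ⟨C, hC, x, hpos, hl, rfl⟩ hN', hneg', hstage⟩

theorem reflTransGen_empty_of_forwardStage (F : CNF) (n : ℕ) (N : Clause)
    (hneg : IsNegativeClause N) (hN : ∀ l ∈ N, l.1 ∈ forwardStage F n) :
    Relation.ReflTransGen (SLDStep F) N ∅ := by
  induction n generalizing N with
  | zero =>
    rw [Finset.eq_empty_of_forall_notMem (s := N) hN]
  | succ n ih =>
    obtain ⟨N', hNN', hneg', hN'⟩ := exists_reflTransGen_forwardStage F n N hneg hN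
    exact hNN'.trans (ih N' hneg' hN')

/-- If a Horn formula is unsatisfiable, the assignment making exactly the forward derivable
variables true falsifies one of its goal clauses. -/
theorem exists_negative_clause_of_unsat {F : CNF} (hHorn : IsHornFormula F)
    (hF : ¬ CnfSatisfiable F) :
    ∃ N ∈ F, IsNegativeClause N ∧ ∃ n, ∀ l ∈ N, l.1 ∈ forwardStage F n := by
  let a : Assignment := fun x => decide (∃ n, x ∈ forwardStage F n)
  have ha : ¬ cnfSat a F := fun h => hF ⟨a, h⟩
  unfold cnfSat at ha
  push Not at ha
  obtain ⟨C, hC, hsat⟩ := ha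
  have hnegLit : ∀ l ∈ C, l.2 = false → ∃ n, l.1 ∈ forwardStage F n := by
    intro l hl hl2
    by_contra hn
    exact hsat ⟨l, hl, by simp only [litSat, a, hl2]; exact decide_eq_false hn⟩
  rcases Nat.le_one_iff_eq_zero_or_eq_one.1 (hHorn C hC) with h0 | h1
  · have hneg : IsNegativeClause C := by
      intro l hl
      by_contra h
      have : l ∈ posLits C := mem_posLits.2 ⟨hl, by simpa using h⟩
      rw [Finset.card_eq_zero.1 h0] at this
      exact Finset.notMem_empty _ this
    exact ⟨C, hC, hneg, exists_forwardStage_of_forall C fun l hl => hnegLit l hl (hneg l hl)⟩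
  · obtain ⟨⟨x, b⟩, hpos⟩ := Finset.card_eq_one.1 h1
    obtain ⟨hxC, rfl⟩ := mem_posLits.1 (hpos ▸ Finset.mem_singleton_self (x, b))
    obtain ⟨n, hn⟩ := exists_forwardStage_of_forall (F := F) (C.erase (x, true)) fun l hl =>
      hnegLit l (Finset.mem_of_mem_erase hl) (snd_eq_false_of_mem_erase hpos hl)
    exact absurd ⟨(x, true), hxC, decide_eq_true ⟨n + 1, C, hC, hpos, hn⟩⟩ hsat

theorem exists_isSLDRefutation_of_reflTransGen {F : CNF} {N : Clause} (hN : N ∈ F)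
    (hneg : IsNegativeClause N) (h : Relation.ReflTransGen (SLDStep F) N ∅) :
    ∃ L, IsSLDRefutation F L := by
  obtain ⟨l, hl, hlast⟩ := List.exists_isChain_cons_of_relationReflTransGen h
  exact ⟨N :: l, List.cons_ne_nil _ _, hN, hneg, hlast,
    fun i hi => List.isChain_iff_getElem.1 hl i hi⟩

theorem IsSLDRefutation.not_cnfSatisfiable {F : CNF} {L : List Clause}
    (h : IsSLDRefutation F L) : ¬ CnfSatisfiable F := by
  rintro ⟨a, ha⟩
  obtain ⟨hL, hhead, -, hlast, hstep⟩ := h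
  have hsat : ∀ i (hi : i < L.length), clauseSat a L[i] := by
    intro i
    induction i with
    | zero =>
      intro hi
      rw [← List.head_eq_getElem_zero hL]
      exact ha _ hhead
    | succ i ih =>
      intro hi
      exact SLDStep.clauseSat (hstep i hi) ha (ih (Nat.lt_of_succ_lt hi))
  refine not_clauseSat_empty a ?_
  rw [← hlast, List.getLast_eq_getElem hL]
  exact hsat _ _

/-- SLD-resolution is sound and complete for propositional Horn
formulas: a Horn formula is unsatisfiable iff it has an SLD-resolution refutation. -/
theorem statement_4 (F : CNF) (hHorn : IsHornFormula F) :
    ¬ CnfSatisfiable F ↔ ∃ L : List Clause, IsSLDRefutation F L := by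
  refine ⟨fun hF => ?_, fun ⟨_, hL⟩ => hL.not_cnfSatisfiable⟩
  obtain ⟨N, hN, hneg, n, hn⟩ := exists_negative_clause_of_unsat hHorn hF
  exact exists_isSLDRefutation_of_reflTransGen hN hneg
    (reflTransGen_empty_of_forwardStage F n N hneg hn)

end QHornProlog
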